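/- arXiv:2509.17443 — 6 statements merged into one kernel-verified Lean document; each statement's English description precedes it below -/
import Mathlib

section
/- There exist constants C > 0 and λ' > 0, depending only on C₀ and λ, such that for every horizon T ≥ 1, every triple (α, β, γ) ∈ 𝓔(T, λ, C₀), and every t ∈ [0, T], one has α(t) + γ(t) ≤ C (e^{−λ' t} + e^{−λ'(T−t)}) (α(T) + γ(0)). -/
open MeasureTheory

/-- `f` is càdlàg on `[a, b]`: right-continuous at every point of `[a, b)` and
with a (finite) left limit at every point of `(a, b]`. -/
def CadlagOn (f : ℝ → ℝ) (a b : ℝ) : Prop :=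
  (∀ t ∈ Set.Ico a b, Filter.Tendsto f (nhdsWithin t (Set.Ioi t)) (nhds (f t))) ∧
  (∀ t ∈ Set.Ioc a b, ∃ L : ℝ, Filter.Tendsto f (nhdsWithin t (Set.Iio t)) (nhds L))

/-- The class `𝓔(T, λ, C₀)` of triples of nonnegative càdlàg integrable functions
on `[0, T]` satisfying the four structural inequalities. -/
structure MemE (T lam C₀ : ℝ) (α β γ : ℝ → ℝ) : Prop where
  cadlag_alpha : CadlagOn α 0 T
  cadlag_beta : CadlagOn β 0 T
  cadlag_gamma : CadlagOn γ 0 T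
  nonneg_alpha : ∀ t ∈ Set.Icc 0 T, 0 ≤ α t
  nonneg_beta : ∀ t ∈ Set.Icc 0 T, 0 ≤ β t
  nonneg_gamma : ∀ t ∈ Set.Icc 0 T, 0 ≤ γ t
  int_alpha : IntervalIntegrable α MeasureTheory.volume 0 T
  int_beta : IntervalIntegrable β MeasureTheory.volume 0 T
  int_gamma : IntervalIntegrable γ MeasureTheory.volume 0 T
  ineq1 : ∀ t₁ t₂, 0 ≤ t₁ → t₁ ≤ t₂ → t₂ ≤ T →
    (∫ t in t₁..t₂, β t) ≤
      C₀ * (Real.sqrt (α t₁ * γ t₁) + Real.sqrt (α t₂ * γ t₂))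
  ineq2 : ∀ t₁ t₂, 0 ≤ t₁ → t₁ ≤ t₂ → t₂ ≤ T →
    γ t₂ ≤ C₀ * Real.exp (-lam * (t₂ - t₁)) * γ t₁ + C₀ * ∫ t in t₁..t₂, β t
  ineq3 : ∀ t₁ t₂, 0 ≤ t₁ → t₁ ≤ t₂ → t₂ ≤ T →
    α t₁ ≤ C₀ * Real.exp (-lam * (t₂ - t₁)) * α t₂ + C₀ * (∫ t in t₁..t₂, β t)
      + C₀ * sSup (γ '' Set.Icc t₁ t₂)
  ineq4 : ∀ t ∈ Set.Icc 0 T, α t ≤ C₀ * β t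

namespace MemE

variable {T lam C₀ : ℝ} {α β γ : ℝ → ℝ}

lemma intervalIntegrable_beta (h : MemE T lam C₀ α β γ) {a b : ℝ} (ha : 0 ≤ a) (hab : a ≤ b)
    (hb : b ≤ T) : IntervalIntegrable β volume a b :=
  h.int_beta.mono_set <| by
    rw [Set.uIcc_of_le hab, Set.uIcc_of_le (ha.trans (hab.trans hb))]
    exact Set.Icc_subset_Icc ha hb

lemma integral_beta_mono (h : MemE T lam C₀ α β γ) {a s t b : ℝ} (ha : 0 ≤ a) (has : a ≤ s)
    (hst : s ≤ t) (htb : t ≤ b) (hb : b ≤ T) : ∫ x in s..t, β x ≤ ∫ x in a..b, β x := by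
  refine intervalIntegral.integral_mono_interval has hst htb ?_
    (h.intervalIntegrable_beta ha (has.trans (hst.trans htb)) hb)
  refine (ae_restrict_mem measurableSet_Ioc).mono fun x hx => ?_
  exact h.nonneg_beta x ⟨ha.trans hx.1.le, hx.2.trans hb⟩

lemma integral_beta_nonneg (h : MemE T lam C₀ α β γ) {a b : ℝ} (ha : 0 ≤ a) (hab : a ≤ b)
    (hb : b ≤ T) : 0 ≤ ∫ x in a..b, β x :=
  intervalIntegral.integral_nonneg hab fun x hx => h.nonneg_beta x ⟨ha.trans hx.1, hx.2.trans hb⟩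

lemma gamma_le (h : MemE T lam C₀ α β γ) (hlam : 0 < lam) (hC₀ : 0 < C₀) {a b s : ℝ} (ha : 0 ≤ a)
    (has : a ≤ s) (hsb : s ≤ b) (hb : b ≤ T) :
    γ s ≤ C₀ * γ a + C₀ * ∫ x in a..b, β x := by
  have hexp : Real.exp (-lam * (s - a)) ≤ 1 := Real.exp_le_one_iff.2 (by nlinarith)
  have hγ := h.nonneg_gamma a ⟨ha, has.trans (hsb.trans hb)⟩
  calc γ s ≤ C₀ * Real.exp (-lam * (s - a)) * γ a + C₀ * ∫ x in a..s, β x :=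
        h.ineq2 a s ha has (hsb.trans hb)
    _ ≤ C₀ * 1 * γ a + C₀ * ∫ x in a..b, β x := by
        gcongr
        exact h.integral_beta_mono ha le_rfl has hsb hb
    _ = _ := by ring

lemma alpha_le (h : MemE T lam C₀ α β γ) (hlam : 0 < lam) (hC₀ : 0 < C₀) {a b s : ℝ} (ha : 0 ≤ a)
    (has : a ≤ s) (hsb : s ≤ b) (hb : b ≤ T) :
    α s ≤ C₀ * α b + C₀ * (∫ x in a..b, β x) + C₀ * (C₀ * γ a + C₀ * ∫ x in a..b, β x) := by
  have hexp : Real.exp (-lam * (b - s)) ≤ 1 := Real.exp_le_one_iff.2 (by nlinarith)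
  have hα := h.nonneg_alpha b ⟨ha.trans (has.trans hsb), hb⟩
  calc α s ≤ C₀ * Real.exp (-lam * (b - s)) * α b + C₀ * (∫ x in s..b, β x)
        + C₀ * sSup (γ '' Set.Icc s b) := h.ineq3 s b (ha.trans has) hsb hb
    _ ≤ C₀ * 1 * α b + C₀ * (∫ x in a..b, β x)
        + C₀ * (C₀ * γ a + C₀ * ∫ x in a..b, β x) := by
        gcongr
        · exact h.integral_beta_mono ha has hsb le_rfl hb
        · refine csSup_le ((Set.nonempty_Icc.2 hsb).image γ) ?_
          rintro _ ⟨u, hu, rfl⟩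
          exact h.gamma_le hlam hC₀ ha (has.trans hu.1) hu.2 hb
    _ = _ := by ring

/-- On every subinterval `[a, b]`, the triple is controlled by the boundary values
`α b` and `γ a`. -/
lemma exists_uniform_bound (hlam : 0 < lam) (hC₀ : 0 < C₀) :
    ∃ C : ℝ, 0 < C ∧ ∀ {T : ℝ} {α β γ : ℝ → ℝ}, MemE T lam C₀ α β γ →
      ∀ {a b : ℝ}, 0 ≤ a → a ≤ b → b ≤ T →
        (∫ x in a..b, β x) ≤ C * (α b + γ a) ∧
          ∀ s ∈ Set.Icc a b, α s + γ s ≤ C * (α b + γ a) := by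
  set K := C₀ + C₀ ^ 2 with hK
  set Q := 4 * C₀ ^ 2 * K with hQ
  have hK0 : 0 < K := by positivity
  have hQ0 : 0 < Q := by positivity
  refine ⟨Q + 1 + 2 * K * (Q + 2), by positivity, fun {T α β γ} h {a b} ha hab hb => ?_⟩
  have hαa := h.nonneg_alpha a ⟨ha, hab.trans hb⟩
  have hαb := h.nonneg_alpha b ⟨ha.trans hab, hb⟩
  have hγa := h.nonneg_gamma a ⟨ha, hab.trans hb⟩
  have hγb := h.nonneg_gamma b ⟨ha.trans hab, hb⟩
  have hB0 := h.integral_beta_nonneg ha hab hb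
  have hint := h.ineq1 a b ha hab hb
  have hγs := fun s (hs : s ∈ Set.Icc a b) => h.gamma_le hlam hC₀ ha hs.1 hs.2 hb
  have hαs := fun s (hs : s ∈ Set.Icc a b) => h.alpha_le hlam hC₀ ha hs.1 hs.2 hb
  set B := ∫ x in a..b, β x
  set M := α b + γ a with hM
  have hM0 : 0 ≤ M := by positivity
  have hγK : ∀ s ∈ Set.Icc a b, γ s ≤ K * (M + B) := fun s hs => by
    refine (hγs s hs).trans ?_
    have : 0 ≤ C₀ * α b + C₀ ^ 2 * (M + B) := by positivity
    rw [hK]; linarith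
  have hαK : ∀ s ∈ Set.Icc a b, α s ≤ K * (M + B) := fun s hs => by
    refine (hαs s hs).trans ?_
    have : 0 ≤ C₀ * γ a + C₀ ^ 2 * α b := by positivity
    rw [hK]; linarith
  have hsqrt : B ≤ 2 * C₀ * Real.sqrt (K * (M + B) * M) := by
    have h1 : Real.sqrt (α a * γ a) ≤ Real.sqrt (K * (M + B) * M) := by
      apply Real.sqrt_le_sqrt
      exact mul_le_mul (hαK a ⟨le_rfl, hab⟩) (by linarith) hγa (by positivity)
    have h2 : Real.sqrt (α b * γ b) ≤ Real.sqrt (K * (M + B) * M) := by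
      apply Real.sqrt_le_sqrt
      rw [mul_comm]
      exact mul_le_mul (hγK b ⟨hab, le_rfl⟩) (by linarith) hαb (by positivity)
    calc B ≤ C₀ * (Real.sqrt (α a * γ a) + Real.sqrt (α b * γ b)) := hint
      _ ≤ C₀ * (Real.sqrt (K * (M + B) * M) + Real.sqrt (K * (M + B) * M)) := by gcongr
      _ = _ := by ring
  have hsq : B ^ 2 ≤ Q * (M + B) * M := by
    calc B ^ 2 ≤ (2 * C₀ * Real.sqrt (K * (M + B) * M)) ^ 2 := by gcongr
      _ = Q * (M + B) * M := by
        rw [mul_pow, Real.sq_sqrt (by positivity), hQ]; ring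
  have hBM : B ≤ (Q + 1) * M := by
    by_contra! hlt
    have h1 : 0 < B := (by positivity : 0 ≤ (Q + 1) * M).trans_lt hlt
    have h2 : (Q + 1) * M * B < B * B := mul_lt_mul_of_pos_right hlt h1
    have h3 : M * ((Q + 1) * M) ≤ M * B := mul_le_mul_of_nonneg_left hlt.le hM0
    nlinarith [sq_nonneg M]
  constructor
  · refine hBM.trans (mul_le_mul_of_nonneg_right ?_ hM0)
    have : 0 < 2 * K * (Q + 2) := by positivity
    linarith
  · intro s hs
    have h1 : K * (M + B) ≤ K * ((Q + 2) * M) := by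
      gcongr
      linarith
    have h2 : 0 ≤ (Q + 1) * M := by positivity
    linarith [hγK s hs, hαK s hs]

/-- If `γ` and the mass of `β` are at most `D` on a long enough interval, then `α + γ` is
at most `ε * D` somewhere on it. -/
lemma exists_small_point (hlam : 0 < lam) (hC₀ : 0 < C₀) {ε : ℝ} (hε : 0 < ε) :
    ∃ L : ℝ, 0 < L ∧ ∀ {T : ℝ} {α β γ : ℝ → ℝ}, MemE T lam C₀ α β γ →
      ∀ {p D : ℝ}, 0 ≤ p → p + L ≤ T → (∫ x in p..p + L, β x) ≤ D →
        (∀ s ∈ Set.Icc p (p + L), γ s ≤ D) →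
          ∃ t ∈ Set.Icc p (p + L), α t + γ t ≤ ε * D := by
  obtain ⟨l, hl, hexp⟩ : ∃ l : ℝ, 0 < l ∧ C₀ * Real.exp (-lam * l) ≤ ε / 3 := by
    have hlim : Filter.Tendsto (fun l : ℝ => C₀ * Real.exp (-lam * l)) Filter.atTop (nhds 0) := by
      simpa using (Real.tendsto_exp_atBot.comp
        (Filter.tendsto_id.const_mul_atTop_of_neg (neg_neg_of_pos hlam))).const_mul C₀
    obtain ⟨l, hle, hl⟩ := ((hlim.eventually_le_const (by positivity : 0 < ε / 3)).and
      (Filter.eventually_gt_atTop 0)).exists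
    exact ⟨l, hl, hle⟩
  obtain ⟨n, hn⟩ := exists_nat_ge (max 1 (max (C₀ / (ε / 3)) (C₀ / l / (ε / 3))))
  have hn1 : (1 : ℝ) ≤ n := (le_max_left _ _).trans hn
  have hn0 : (0 : ℝ) < n := by linarith
  have hCn : C₀ / n ≤ ε / 3 := by
    rw [div_le_comm₀ hn0 (by positivity)]
    exact (le_max_left _ _).trans ((le_max_right _ _).trans hn)
  have hCln : C₀ / l / n ≤ ε / 3 := by
    rw [div_le_comm₀ hn0 (by positivity)]
    exact (le_max_right _ _).trans ((le_max_right _ _).trans hn)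
  refine ⟨n * (2 * l), by positivity, fun {T α β γ} h {p D} hp hT hβ hγ => ?_⟩
  have hD : 0 ≤ D := (h.integral_beta_nonneg hp (by linarith [mul_pos hn0 hl]) hT).trans hβ
  obtain ⟨i, hi, hiβ⟩ : ∃ i ∈ Finset.range n,
      ∫ x in (p + i * (2 * l))..(p + (i + 1 : ℕ) * (2 * l)), β x ≤ D / n := by
    apply Finset.exists_le_of_sum_le
    · exact Finset.nonempty_range_iff.2 (by rintro rfl; simp at hn0)
    · rw [intervalIntegral.sum_integral_adjacent_intervals
        (a := fun i : ℕ => p + i * (2 * l))]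
      · simp only [Nat.cast_zero, zero_mul, add_zero, Finset.sum_const, Finset.card_range,
          nsmul_eq_mul]
        rwa [mul_div_cancel₀ _ hn0.ne']
      · intro k hk
        have hkn : ((k + 1 : ℕ) : ℝ) ≤ n := by exact_mod_cast hk
        apply h.intervalIntegrable_beta (by positivity)
        · gcongr; simp
        · refine le_trans ?_ hT
          gcongr
  have hin : ((i : ℝ) + 1) ≤ n := by exact_mod_cast Finset.mem_range.1 hi
  push_cast at hiβ
  set s := p + i * (2 * l) with hs
  have hps : p ≤ s := by rw [hs]; linarith [(by positivity : 0 ≤ (i : ℝ) * (2 * l))]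
  have hend : p + (i + 1) * (2 * l) = s + 2 * l := by rw [hs]; ring
  have hsL : s + 2 * l ≤ p + n * (2 * l) := by rw [← hend]; gcongr
  rw [hend] at hiβ
  have hs0 : 0 ≤ s := hp.trans hps
  obtain ⟨t, ht, hβt⟩ : ∃ t ∈ Set.Ioc (s + l) (s + 2 * l), β t ≤ D / n / l := by
    have hvol : volume.real (Set.Ioc (s + l) (s + 2 * l)) = l := by
      rw [Real.volume_real_Ioc_of_le (by linarith)]; ring
    have hii := h.intervalIntegrable_beta (a := s + l) (b := s + 2 * l) (by linarith)
      (by linarith) (by linarith)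
    obtain ⟨t, ht, hle⟩ := exists_le_setAverage (μ := volume) (f := β)
      (s := Set.Ioc (s + l) (s + 2 * l)) (by simp; linarith) (by simp)
      ((intervalIntegrable_iff_integrableOn_Ioc_of_le (by linarith)).1 hii)
    refine ⟨t, ht, hle.trans ?_⟩
    rw [setAverage_eq, hvol, smul_eq_mul, ← intervalIntegral.integral_of_le (by linarith),
      inv_mul_eq_div]
    gcongr
    exact (h.integral_beta_mono hs0 (by linarith) (by linarith) le_rfl (by linarith)).trans hiβ
  refine ⟨t, ⟨by linarith [ht.1], by linarith [ht.2]⟩, ?_⟩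
  have hα : α t ≤ ε / 3 * D :=
    calc α t ≤ C₀ * β t := h.ineq4 t ⟨by linarith [ht.1], by linarith [ht.2]⟩
      _ ≤ C₀ * (D / n / l) := by gcongr
      _ = C₀ / l / n * D := by ring
      _ ≤ ε / 3 * D := by gcongr
  have hγt : γ t ≤ ε / 3 * D + ε / 3 * D :=
    calc γ t ≤ C₀ * Real.exp (-lam * (t - s)) * γ s + C₀ * ∫ x in s..t, β x :=
          h.ineq2 s t hs0 (by linarith [ht.1]) (by linarith [ht.2])
      _ ≤ C₀ * Real.exp (-lam * l) * D + C₀ * (D / n) := by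
          have h1 : Real.exp (-lam * (t - s)) ≤ Real.exp (-lam * l) :=
            Real.exp_le_exp.2 (by nlinarith [ht.1])
          have h2 : γ s ≤ D := hγ s ⟨hps, by linarith⟩
          have h3 : ∫ x in s..t, β x ≤ D / n :=
            (h.integral_beta_mono hs0 le_rfl (by linarith [ht.1]) ht.2 (by linarith)).trans hiβ
          have h4 : 0 ≤ γ s := h.nonneg_gamma s ⟨hs0, by linarith⟩
          gcongr
      _ = C₀ * Real.exp (-lam * l) * D + C₀ / n * D := by ring
      _ ≤ ε / 3 * D + ε / 3 * D := by gcongr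
  linarith

/-- Moving a further distance `L` away from both endpoints halves the bound. -/
lemma exists_geometric_decay (hlam : 0 < lam) (hC₀ : 0 < C₀) :
    ∃ C : ℝ, 0 < C ∧ ∃ L : ℝ, 0 < L ∧ ∀ {T : ℝ} {α β γ : ℝ → ℝ}, MemE T lam C₀ α β γ →
      ∀ (k : ℕ) {a b t : ℝ}, 0 ≤ a → b ≤ T → a + k * L ≤ t → t ≤ b - k * L →
        α t + γ t ≤ C * (1 / 2) ^ k * (α b + γ a) := by
  obtain ⟨C, hC, hbound⟩ := exists_uniform_bound hlam hC₀
  obtain ⟨L, hL, hsmall⟩ := exists_small_point hlam hC₀ (ε := 1 / (4 * C)) (by positivity)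
  refine ⟨C, hC, L, hL, fun {T α β γ} h k => ?_⟩
  induction k with
  | zero =>
    intro a b t ha hb hat htb
    simp only [Nat.cast_zero, zero_mul, add_zero, sub_zero] at hat htb
    simpa using (hbound h ha (hat.trans htb) hb).2 t ⟨hat, htb⟩
  | succ k ih =>
    intro a b t ha hb hat htb
    push_cast at hat htb
    have hkL : 0 ≤ (k : ℝ) * L := by positivity
    have hab : a ≤ b := by linarith
    obtain ⟨hβ, hαγ⟩ := hbound h ha hab hb
    set M := α b + γ a
    have hγ : ∀ s ∈ Set.Icc a b, γ s ≤ C * M := fun s hs => by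
      linarith [hαγ s hs, h.nonneg_alpha s ⟨ha.trans hs.1, hs.2.trans hb⟩]
    have key : ∀ p, a ≤ p → p + L ≤ b → ∃ u ∈ Set.Icc p (p + L), α u + γ u ≤ M / 4 := by
      intro p hp hpb
      obtain ⟨u, hu, hle⟩ := hsmall h (ha.trans hp) (hpb.trans hb)
        ((h.integral_beta_mono ha hp (by linarith) hpb hb).trans hβ)
        (fun s hs => hγ s ⟨hp.trans hs.1, hs.2.trans hpb⟩)
      refine ⟨u, hu, hle.trans_eq ?_⟩
      field_simp
    obtain ⟨u, hu, hule⟩ := key a le_rfl (by linarith)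
    obtain ⟨v, hv, hvle⟩ := key (b - L) (by linarith) (by linarith)
    have hαu := h.nonneg_alpha u ⟨ha.trans hu.1, by linarith [hu.2]⟩
    have hγv := h.nonneg_gamma v ⟨by linarith [hv.1], by linarith [hv.2]⟩
    calc α t + γ t ≤ C * (1 / 2) ^ k * (α v + γ u) :=
          ih (ha.trans hu.1) (by linarith [hv.2]) (by linarith [hu.2]) (by linarith [hv.1])
      _ ≤ C * (1 / 2) ^ k * (M / 2) := by
          gcongr
          linarith
      _ = C * (1 / 2) ^ (k + 1) * M := by ring

end MemE

/-- Lemma B.1 (exponential decay, finite horizon): there exist `C, λ' > 0` depending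
only on `C₀` and `λ` such that for every `T ≥ 1`, every `(α, β, γ) ∈ 𝓔(T, λ, C₀)` and
every `t ∈ [0, T]`,
`α(t) + γ(t) ≤ C (e^{-λ' t} + e^{-λ'(T - t)}) (α(T) + γ(0))`. -/
theorem expo_decay_finite (lam C₀ : ℝ) (hlam : 0 < lam) (hC₀ : 0 < C₀) :
    ∃ C : ℝ, 0 < C ∧ ∃ lam' : ℝ, 0 < lam' ∧
      ∀ T : ℝ, 1 ≤ T → ∀ α β γ : ℝ → ℝ, MemE T lam C₀ α β γ →
        ∀ t ∈ Set.Icc (0 : ℝ) T,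
          α t + γ t ≤
            C * (Real.exp (-lam' * t) + Real.exp (-lam' * (T - t))) * (α T + γ 0) := by
  obtain ⟨C, hC, L, hL, hdecay⟩ := MemE.exists_geometric_decay hlam hC₀
  have hlog : 0 < Real.log 2 := Real.log_pos one_lt_two
  refine ⟨C * 2, by positivity, Real.log 2 / L, by positivity, fun T _ α β γ h t ht => ?_⟩
  set m := min t (T - t)
  have hm : 0 ≤ m := le_min ht.1 (by linarith [ht.2])
  have hkL : (⌊m / L⌋₊ : ℝ) * L ≤ m := (le_div_iff₀ hL).1 (Nat.floor_le (by positivity))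
  have hM : 0 ≤ α T + γ 0 :=
    add_nonneg (h.nonneg_alpha T ⟨ht.1.trans ht.2, le_rfl⟩)
      (h.nonneg_gamma 0 ⟨le_rfl, ht.1.trans ht.2⟩)
  have hpow : (1 / 2 : ℝ) ^ ⌊m / L⌋₊ ≤ 2 * Real.exp (-(Real.log 2 / L) * m) := by
    have hhalf : (1 / 2 : ℝ) = Real.exp (-Real.log 2) := by
      rw [Real.exp_neg, Real.exp_log two_pos, one_div]
    have htwo : (2 : ℝ) = Real.exp (Real.log 2) := (Real.exp_log two_pos).symm
    rw [hhalf, ← Real.exp_nat_mul]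
    nth_rewrite 2 [htwo]
    rw [← Real.exp_add, Real.exp_le_exp]
    have hfloor := Nat.lt_floor_add_one (m / L)
    have := mul_le_mul_of_nonneg_left hfloor.le hlog.le
    have heq : -(Real.log 2 / L) * m = -(Real.log 2 * (m / L)) := by ring
    rw [heq]
    linarith
  have hexp : Real.exp (-(Real.log 2 / L) * m) ≤
      Real.exp (-(Real.log 2 / L) * t) + Real.exp (-(Real.log 2 / L) * (T - t)) := by
    rcases min_choice t (T - t) with hmin | hmin
    · exact (congrArg (fun x => Real.exp (-(Real.log 2 / L) * x)) hmin).trans_le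
        (le_add_of_nonneg_right (Real.exp_nonneg _))
    · exact (congrArg (fun x => Real.exp (-(Real.log 2 / L) * x)) hmin).trans_le
        (le_add_of_nonneg_left (Real.exp_nonneg _))
  calc α t + γ t ≤ C * (1 / 2) ^ ⌊m / L⌋₊ * (α T + γ 0) :=
        hdecay h _ le_rfl le_rfl (by linarith [min_le_left t (T - t)])
          (by linarith [min_le_right t (T - t)])
    _ ≤ C * (2 * (Real.exp (-(Real.log 2 / L) * t) + Real.exp (-(Real.log 2 / L) * (T - t)))) *
        (α T + γ 0) := by
        gcongr
        exact hpow.trans (by gcongr)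
    _ = _ := by ring
end

section
/- There exists a constant C > 0, depending only on C₀ and λ, such that for every horizon T > 0 and every triple (α, β, γ) ∈ 𝓔(T, λ, C₀) with α(0) + γ(0) + α(T) + γ(T) ≤ 1, one has ∫_{0}^{T} β(t) dt ≤ C₀ and α(t) + γ(t) ≤ C for all t ∈ [0, T]. -/
open MeasureTheory

theorem sqrt_mul_le_half_add {x y : ℝ} (hx : 0 ≤ x) (hy : 0 ≤ y) :
    Real.sqrt (x * y) ≤ (x + y) / 2 := by
  rw [Real.sqrt_le_left (by linarith)]
  nlinarith [sq_nonneg (x - y)]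

/-- A damped value `c * e^{-λ s} * x` with `0 ≤ x ≤ 1` is at most `c`. -/
theorem mul_exp_neg_mul_le {c lam s x : ℝ} (hc : 0 ≤ c) (hlam : 0 ≤ lam) (hs : 0 ≤ s)
    (hx : 0 ≤ x) (hx1 : x ≤ 1) : c * Real.exp (-lam * s) * x ≤ c := by
  have hexp : Real.exp (-lam * s) ≤ 1 := Real.exp_le_one_iff.mpr (by nlinarith)
  rw [mul_assoc]
  exact mul_le_of_le_one_right hc (mul_le_one₀ hexp hx hx1)

/-- A priori bounds: there exists `C > 0` depending only on `C₀` and `λ` such that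
for every `T > 0` and every `(α, β, γ) ∈ 𝓔(T, λ, C₀)` with
`α(0) + γ(0) + α(T) + γ(T) ≤ 1`, one has `∫₀^T β ≤ C₀` and `α(t) + γ(t) ≤ C` on `[0,T]`. -/
theorem apriori_bounds (lam C₀ : ℝ) (hlam : 0 < lam) (hC₀ : 0 < C₀) :
    ∃ C : ℝ, 0 < C ∧
      ∀ T : ℝ, 0 < T → ∀ α β γ : ℝ → ℝ, MemE T lam C₀ α β γ →
        α 0 + γ 0 + α T + γ T ≤ 1 →
          (∫ t in (0:ℝ)..T, β t) ≤ C₀ ∧ ∀ t ∈ Set.Icc (0 : ℝ) T, α t + γ t ≤ C := by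
  refine ⟨C₀ + C₀ * C₀ + C₀ * (C₀ + C₀ * C₀) + (C₀ + C₀ * C₀), by positivity, ?_⟩
  intro T hT α β γ h hbd
  have h0 : (0 : ℝ) ∈ Set.Icc 0 T := ⟨le_rfl, hT.le⟩
  have hT' : T ∈ Set.Icc 0 T := ⟨hT.le, le_rfl⟩
  have hα0 := h.nonneg_alpha 0 h0
  have hγ0 := h.nonneg_gamma 0 h0
  have hαT := h.nonneg_alpha T hT'
  have hγT := h.nonneg_gamma T hT'
  have hβ : (∫ t in (0:ℝ)..T, β t) ≤ C₀ := by
    refine (h.ineq1 0 T le_rfl hT.le le_rfl).trans (mul_le_of_le_one_right hC₀.le ?_)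
    linarith [sqrt_mul_le_half_add hα0 hγ0, sqrt_mul_le_half_add hαT hγT]
  have hβsub : ∀ a b, 0 ≤ a → a ≤ b → b ≤ T → (∫ t in a..b, β t) ≤ C₀ := by
    intro a b ha hab hb
    refine (intervalIntegral.integral_mono_interval ha hab hb ?_ h.int_beta).trans hβ
    filter_upwards [ae_restrict_mem measurableSet_Ioc] with t ht
    exact h.nonneg_beta t ⟨ht.1.le, ht.2⟩
  have hγ : ∀ t ∈ Set.Icc 0 T, γ t ≤ C₀ + C₀ * C₀ := fun t ht =>
    (h.ineq2 0 t le_rfl ht.1 ht.2).trans <| add_le_add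
      (mul_exp_neg_mul_le hC₀.le hlam.le (by linarith [ht.1]) hγ0 (by linarith))
      (mul_le_mul_of_nonneg_left (hβsub 0 t le_rfl ht.1 ht.2) hC₀.le)
  refine ⟨hβ, fun t ht => add_le_add ?_ (hγ t ht)⟩
  have hsup : sSup (γ '' Set.Icc t T) ≤ C₀ + C₀ * C₀ := by
    refine csSup_le ((Set.nonempty_Icc.mpr ht.2).image γ) ?_
    rintro _ ⟨s, hs, rfl⟩
    exact hγ s ⟨ht.1.trans hs.1, hs.2⟩
  exact (h.ineq3 t T ht.1 ht.2 le_rfl).trans <| add_le_add (add_le_add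
    (mul_exp_neg_mul_le hC₀.le hlam.le (by linarith [ht.2]) hαT (by linarith))
    (mul_le_mul_of_nonneg_left (hβsub t T ht.1 ht.2 le_rfl) hC₀.le))
    (mul_le_mul_of_nonneg_left hsup hC₀.le)
end

section
/- There exists a constant C > 0, depending only on C₀ and λ, such that for every ε ∈ (0, 1], every horizon T ≥ 4/ε, every triple (α, β, γ) ∈ 𝓔(T, λ, C₀) with α(0) + γ(0) + α(T) + γ(T) ≤ 1, and every t ∈ [2/ε, T − 2/ε], one has α(t) + γ(t) ≤ C (e^{−λ/ε} + ε^{1/2}). -/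
open MeasureTheory

/-- On a subinterval, the integral of `β` is at most its integral over `[0, T]`. -/
lemma MemE.integral_beta_mono_s3 {T lam C₀ : ℝ} {α β γ : ℝ → ℝ} (h : MemE T lam C₀ α β γ)
    {c d s t : ℝ} (hc : 0 ≤ c) (hcs : c ≤ s) (hst : s ≤ t) (htd : t ≤ d) (hd : d ≤ T) :
    ∫ x in s..t, β x ≤ ∫ x in c..d, β x := by
  refine intervalIntegral.integral_mono_interval hcs hst htd ?_ ?_
  · filter_upwards [ae_restrict_mem measurableSet_Ioc] with x hx
    exact h.nonneg_beta x ⟨hc.trans hx.1.le, hx.2.trans hd⟩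
  · refine h.int_beta.mono_set ?_
    rw [Set.uIcc_of_le (by linarith), Set.uIcc_of_le (by linarith)]
    exact Set.Icc_subset_Icc hc hd

/-- Endpoint data of size at most one bound the total integral of `β`. -/
lemma MemE.integral_beta_le {T lam C₀ : ℝ} {α β γ : ℝ → ℝ} (h : MemE T lam C₀ α β γ)
    (hC₀ : 0 < C₀) (hT : 0 ≤ T) (hb : α 0 + γ 0 + α T + γ T ≤ 1) :
    ∫ x in (0 : ℝ)..T, β x ≤ C₀ / 2 := by
  have amgm : ∀ x y : ℝ, 0 ≤ x → 0 ≤ y → √(x * y) ≤ (x + y) / 2 := fun x y hx hy =>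
    Real.sqrt_le_iff.2 ⟨by positivity, by nlinarith [sq_nonneg (x - y)]⟩
  have h0 : (0 : ℝ) ∈ Set.Icc 0 T := ⟨le_rfl, hT⟩
  have hT' : T ∈ Set.Icc 0 T := ⟨hT, le_rfl⟩
  have e0 := amgm _ _ (h.nonneg_alpha 0 h0) (h.nonneg_gamma 0 h0)
  have eT := amgm _ _ (h.nonneg_alpha T hT') (h.nonneg_gamma T hT')
  calc ∫ x in (0 : ℝ)..T, β x ≤ C₀ * (√(α 0 * γ 0) + √(α T * γ T)) := h.ineq1 0 T le_rfl hT le_rfl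
    _ ≤ C₀ * (1 / 2) := by gcongr; linarith
    _ = C₀ / 2 := by ring

/-- Under endpoint data of size at most one, `γ` is uniformly bounded. -/
lemma MemE.gamma_le_s3 {T lam C₀ : ℝ} {α β γ : ℝ → ℝ} (h : MemE T lam C₀ α β γ)
    (hlam : 0 < lam) (hC₀ : 0 < C₀) (hb : α 0 + γ 0 + α T + γ T ≤ 1)
    {s : ℝ} (hs : s ∈ Set.Icc 0 T) : γ s ≤ C₀ + C₀ ^ 2 := by
  have hT : 0 ≤ T := hs.1.trans hs.2
  have h0 : (0 : ℝ) ∈ Set.Icc 0 T := ⟨le_rfl, hT⟩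
  have hT' : T ∈ Set.Icc 0 T := ⟨hT, le_rfl⟩
  have hγ : γ 0 ≤ 1 := by
    linarith [h.nonneg_alpha 0 h0, h.nonneg_alpha T hT', h.nonneg_gamma T hT']
  have hI : ∫ x in (0 : ℝ)..s, β x ≤ C₀ := by
    linarith [h.integral_beta_mono_s3 le_rfl le_rfl hs.1 hs.2 le_rfl, h.integral_beta_le hC₀ hT hb]
  have hexp : Real.exp (-lam * (s - 0)) ≤ 1 :=
    Real.exp_le_one_iff.2 (by nlinarith [mul_nonneg hlam.le hs.1])
  calc γ s ≤ C₀ * Real.exp (-lam * (s - 0)) * γ 0 + C₀ * ∫ x in (0 : ℝ)..s, β x :=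
        h.ineq2 0 s le_rfl hs.1 hs.2
    _ ≤ C₀ * 1 * 1 + C₀ * C₀ := by
        have := h.nonneg_gamma 0 h0
        gcongr
    _ = C₀ + C₀ ^ 2 := by ring

/-- Every subinterval of length `1 / ε` contains a point where `α` is of order `ε`. -/
lemma MemE.exists_alpha_le {T lam C₀ ε a : ℝ} {α β γ : ℝ → ℝ} (h : MemE T lam C₀ α β γ)
    (hC₀ : 0 < C₀) (hε : 0 < ε) (hb : α 0 + γ 0 + α T + γ T ≤ 1)
    (ha : 0 ≤ a) (haT : a + 1 / ε ≤ T) :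
    ∃ s ∈ Set.Icc a (a + 1 / ε), α s ≤ C₀ ^ 2 * ε := by
  have hl : 0 < 1 / ε := by positivity
  obtain ⟨s, hs, hβ⟩ : ∃ s ∈ Set.Icc a (a + 1 / ε), β s ≤ C₀ * ε := by
    by_contra! hcon
    have hint : IntervalIntegrable β volume a (a + 1 / ε) := by
      refine h.int_beta.mono_set ?_
      rw [Set.uIcc_of_le (by linarith), Set.uIcc_of_le (by linarith)]
      exact Set.Icc_subset_Icc ha haT
    have hlow := intervalIntegral.integral_mono_on (by linarith : a ≤ a + 1 / ε)
      (intervalIntegrable_const (c := C₀ * ε)) hint fun x hx => (hcon x hx).le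
    have hc : ∫ _ in a..(a + 1 / ε), C₀ * ε = C₀ := by
      rw [intervalIntegral.integral_const, smul_eq_mul]
      field_simp
      ring
    linarith [h.integral_beta_mono_s3 le_rfl ha (by linarith) haT le_rfl,
      h.integral_beta_le hC₀ (by linarith) hb]
  refine ⟨s, hs, (h.ineq4 s ⟨ha.trans hs.1, hs.2.trans haT⟩).trans ?_⟩
  calc C₀ * β s ≤ C₀ * (C₀ * ε) := by gcongr
    _ = C₀ ^ 2 * ε := by ring

/-- Interior smallness: there exists `C > 0` depending only on `C₀` and `λ` such that
for every `ε ∈ (0, 1]`, every `T ≥ 4/ε`, every `(α, β, γ) ∈ 𝓔(T, λ, C₀)` with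
`α(0) + γ(0) + α(T) + γ(T) ≤ 1`, and every `t ∈ [2/ε, T - 2/ε]`,
`α(t) + γ(t) ≤ C (e^{-λ/ε} + ε^{1/2})`. -/
theorem interior_smallness (lam C₀ : ℝ) (hlam : 0 < lam) (hC₀ : 0 < C₀) :
    ∃ C : ℝ, 0 < C ∧
      ∀ ε : ℝ, 0 < ε → ε ≤ 1 →
        ∀ T : ℝ, 4 / ε ≤ T → ∀ α β γ : ℝ → ℝ, MemE T lam C₀ α β γ →
          α 0 + γ 0 + α T + γ T ≤ 1 →
            ∀ t ∈ Set.Icc (2 / ε) (T - 2 / ε),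
              α t + γ t ≤ C * (Real.exp (-lam / ε) + Real.sqrt ε) := by
  obtain ⟨K, hK⟩ : ∃ K, K = C₀ + C₀ ^ 2 := ⟨_, rfl⟩
  obtain ⟨M, hM⟩ : ∃ M, M = 2 * C₀ * √(C₀ ^ 2 * K) := ⟨_, rfl⟩
  have hK0 : 0 < K := by rw [hK]; positivity
  have hM0 : 0 < M := by rw [hM]; positivity
  refine ⟨C₀ * K + C₀ ^ 3 + C₀ ^ 2 * K + 2 * C₀ * M + C₀ ^ 2 * M, by positivity, ?_⟩
  intro ε hε hε1 T hT α β γ h hb t ht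
  have hl : 0 < 1 / ε := by positivity
  have h2 : 2 / ε = 2 * (1 / ε) := by ring
  have h4 : 4 / ε = 4 * (1 / ε) := by ring
  obtain ⟨ht1, ht2⟩ := ht
  rw [h2] at ht1 ht2
  rw [h4] at hT
  obtain ⟨p, hp, hαp⟩ := h.exists_alpha_le (a := 0) hC₀ hε hb le_rfl (by linarith)
  obtain ⟨q, hq, hαq⟩ := h.exists_alpha_le (a := T - 1 / ε) hC₀ hε hb (by linarith) (by linarith)
  obtain ⟨hp1, hp2⟩ := hp
  obtain ⟨hq1, hq2⟩ := hq
  have hpT : p ∈ Set.Icc 0 T := ⟨hp1, by linarith⟩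
  have hqT : q ∈ Set.Icc 0 T := ⟨by linarith, by linarith⟩
  have hprod : ∀ s ∈ Set.Icc 0 T, α s ≤ C₀ ^ 2 * ε → √(α s * γ s) ≤ √(C₀ ^ 2 * K) * √ε := by
    intro s hs hα
    rw [← Real.sqrt_mul (by positivity)]
    refine Real.sqrt_le_sqrt ?_
    calc α s * γ s ≤ C₀ ^ 2 * ε * K :=
          mul_le_mul hα (hK ▸ h.gamma_le_s3 hlam hC₀ hb hs) (h.nonneg_gamma s hs) (by positivity)
      _ = C₀ ^ 2 * K * ε := by ring
  have hI : ∫ x in p..q, β x ≤ M * √ε := by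
    calc ∫ x in p..q, β x ≤ C₀ * (√(α p * γ p) + √(α q * γ q)) :=
          h.ineq1 p q hp1 (by linarith) hqT.2
      _ ≤ C₀ * (√(C₀ ^ 2 * K) * √ε + √(C₀ ^ 2 * K) * √ε) := by
          gcongr
          · exact hprod p hpT hαp
          · exact hprod q hqT hαq
      _ = M * √ε := by rw [hM]; ring
  have hexpo : ∀ d, 1 / ε ≤ d → -lam * d ≤ -lam / ε := by
    intro d hd
    have : -lam / ε = -(lam * (1 / ε)) := by ring
    rw [this]
    nlinarith
  have hγ : ∀ s ∈ Set.Icc t q, γ s ≤ C₀ * K * Real.exp (-lam / ε) + C₀ * M * √ε := by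
    intro s hs
    calc γ s ≤ C₀ * Real.exp (-lam * (s - p)) * γ p + C₀ * ∫ x in p..s, β x :=
          h.ineq2 p s hp1 (by linarith [hs.1]) (hs.2.trans hqT.2)
      _ ≤ C₀ * Real.exp (-lam / ε) * K + C₀ * (M * √ε) := by
          have := h.nonneg_gamma p hpT
          gcongr
          · exact hexpo _ (by linarith [hs.1])
          · exact hK ▸ h.gamma_le_s3 hlam hC₀ hb hpT
          · exact (h.integral_beta_mono_s3 hp1 le_rfl (by linarith [hs.1]) hs.2 hqT.2).trans hI
      _ = C₀ * K * Real.exp (-lam / ε) + C₀ * M * √ε := by ring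
  have htq : t ≤ q := by linarith
  have hsup : sSup (γ '' Set.Icc t q) ≤ C₀ * K * Real.exp (-lam / ε) + C₀ * M * √ε :=
    csSup_le ((Set.nonempty_Icc.2 htq).image γ) (Set.forall_mem_image.2 hγ)
  have hα : α t ≤ C₀ * Real.exp (-lam / ε) * C₀ ^ 2 + C₀ * (M * √ε)
      + C₀ * (C₀ * K * Real.exp (-lam / ε) + C₀ * M * √ε) := by
    refine (h.ineq3 t q (by linarith) htq hqT.2).trans ?_
    have := h.nonneg_alpha q hqT
    gcongr
    · exact hexpo _ (by linarith)
    · exact hαq.trans (mul_le_of_le_one_right (by positivity) hε1)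
    · exact (h.integral_beta_mono_s3 hp1 (by linarith) htq le_rfl hqT.2).trans hI
  have hγt := hγ t ⟨le_rfl, htq⟩
  have hE := Real.exp_pos (-lam / ε)
  have hS := Real.sqrt_nonneg ε
  have hcross : 0 ≤ (C₀ * K + C₀ ^ 3 + C₀ ^ 2 * K) * √ε
      + (2 * C₀ * M + C₀ ^ 2 * M) * Real.exp (-lam / ε) := by positivity
  linarith
end

section
/- Self-improvement of interior bounds for the class 𝓔(·, λ, C₀): let τ ≥ 1 and M > 0, and suppose that for every horizon T' ≥ 2τ, every triple (α, β, γ) ∈ 𝓔(T', λ, C₀) with α(0) + γ(0) + α(T') + γ(T') ≤ 1, and every t ∈ [τ, T' − τ], one has α(t) + γ(t) ≤ M. Then for every horizon T ≥ 4τ, every triple (α, β, γ) ∈ 𝓔(T, λ, C₀) with α(0) + γ(0) + α(T) + γ(T) ≤ 1, and every t ∈ [2τ, T − 2τ], one has α(t) + γ(t) ≤ 2M². -/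
open MeasureTheory

/-- Translating a function that is càdlàg on `[a, b] ⊆ [0, T]` gives a function càdlàg on
`[0, b - a]`. -/
lemma CadlagOn.restrict_shift {f : ℝ → ℝ} {T a b : ℝ} (hf : CadlagOn f 0 T)
    (ha : 0 ≤ a) (hb : b ≤ T) : CadlagOn (fun t => f (t + a)) 0 (b - a) := by
  have hcont (t : ℝ) (s : Set ℝ) :
      Filter.Tendsto (fun x : ℝ => x + a) (nhdsWithin t s) (nhds (t + a)) :=
    ((continuous_add_const a).tendsto t).mono_left nhdsWithin_le_nhds
  refine ⟨fun t ht => ?_, fun t ht => ?_⟩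
  · refine (hf.1 (t + a) ⟨by linarith [ht.1], by linarith [ht.2]⟩).comp ?_
    exact tendsto_nhdsWithin_iff.2 ⟨hcont t _, eventually_nhdsWithin_of_forall
      fun s hs => add_lt_add_left (Set.mem_Ioi.1 hs) a⟩
  · obtain ⟨L, hL⟩ := hf.2 (t + a) ⟨by linarith [ht.1], by linarith [ht.2]⟩
    refine ⟨L, hL.comp ?_⟩
    exact tendsto_nhdsWithin_iff.2 ⟨hcont t _, eventually_nhdsWithin_of_forall
      fun s hs => add_lt_add_left (Set.mem_Iio.1 hs) a⟩

lemma CadlagOn.const_mul {f : ℝ → ℝ} {a b : ℝ} (hf : CadlagOn f a b) (c : ℝ) :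
    CadlagOn (fun t => c * f t) a b :=
  ⟨fun t ht => (hf.1 t ht).const_mul c, fun t ht =>
    let ⟨L, hL⟩ := hf.2 t ht
    ⟨c * L, hL.const_mul c⟩⟩

/-- The class `𝓔` is stable under restriction to a subinterval, translated to start at `0`. -/
lemma MemE.restrict_shift {T lam C₀ a b : ℝ} {α β γ : ℝ → ℝ} (h : MemE T lam C₀ α β γ)
    (ha : 0 ≤ a) (hab : a ≤ b) (hb : b ≤ T) :
    MemE (b - a) lam C₀ (fun t => α (t + a)) (fun t => β (t + a)) (fun t => γ (t + a)) := by
  have hmem {t : ℝ} (ht : t ∈ Set.Icc 0 (b - a)) : t + a ∈ Set.Icc 0 T :=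
    ⟨by linarith [ht.1], by linarith [ht.2]⟩
  have hint {f : ℝ → ℝ} (hf : IntervalIntegrable f volume 0 T) :
      IntervalIntegrable (fun t => f (t + a)) volume 0 (b - a) := by
    have hsub : IntervalIntegrable f volume a b :=
      hf.mono_set (by
        rw [Set.uIcc_of_le hab, Set.uIcc_of_le (by linarith)]
        exact Set.Icc_subset_Icc ha hb)
    simpa using hsub.comp_add_right a
  have hsub (t₁ t₂ : ℝ) : t₂ + a - (t₁ + a) = t₂ - t₁ := by ring
  constructor
  case cadlag_alpha => exact h.cadlag_alpha.restrict_shift ha hb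
  case cadlag_beta => exact h.cadlag_beta.restrict_shift ha hb
  case cadlag_gamma => exact h.cadlag_gamma.restrict_shift ha hb
  case nonneg_alpha => exact fun t ht => h.nonneg_alpha _ (hmem ht)
  case nonneg_beta => exact fun t ht => h.nonneg_beta _ (hmem ht)
  case nonneg_gamma => exact fun t ht => h.nonneg_gamma _ (hmem ht)
  case int_alpha => exact hint h.int_alpha
  case int_beta => exact hint h.int_beta
  case int_gamma => exact hint h.int_gamma
  case ineq1 =>
    intro t₁ t₂ h0 h12 h2
    rw [intervalIntegral.integral_comp_add_right]
    exact h.ineq1 (t₁ + a) (t₂ + a) (by linarith) (by linarith) (by linarith)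
  case ineq2 =>
    intro t₁ t₂ h0 h12 h2
    have := h.ineq2 (t₁ + a) (t₂ + a) (by linarith) (by linarith) (by linarith)
    rwa [hsub, ← intervalIntegral.integral_comp_add_right] at this
  case ineq3 =>
    intro t₁ t₂ h0 h12 h2
    have := h.ineq3 (t₁ + a) (t₂ + a) (by linarith) (by linarith) (by linarith)
    rwa [hsub, ← intervalIntegral.integral_comp_add_right, ← Set.image_add_const_Icc,
      Set.image_image] at this
  case ineq4 => exact fun t ht => h.ineq4 _ (hmem ht)

/-- The class `𝓔` is stable under multiplication of the triple by a nonnegative constant. -/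
lemma MemE.const_mul {T lam C₀ c : ℝ} {α β γ : ℝ → ℝ} (h : MemE T lam C₀ α β γ)
    (hc : 0 ≤ c) :
    MemE T lam C₀ (fun t => c * α t) (fun t => c * β t) (fun t => c * γ t) := by
  have hsqrt (x y : ℝ) : √(c * x * (c * y)) = c * √(x * y) := by
    rw [show c * x * (c * y) = c ^ 2 * (x * y) by ring, Real.sqrt_mul (sq_nonneg c),
      Real.sqrt_sq hc]
  have hsup (s : Set ℝ) : sSup ((fun t => c * γ t) '' s) = c * sSup (γ '' s) := by
    rw [← smul_eq_mul c, ← Real.sSup_smul_of_nonneg hc, ← Set.image_smul, Set.image_image]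
    rfl
  constructor
  case cadlag_alpha => exact h.cadlag_alpha.const_mul c
  case cadlag_beta => exact h.cadlag_beta.const_mul c
  case cadlag_gamma => exact h.cadlag_gamma.const_mul c
  case nonneg_alpha => exact fun t ht => mul_nonneg hc (h.nonneg_alpha t ht)
  case nonneg_beta => exact fun t ht => mul_nonneg hc (h.nonneg_beta t ht)
  case nonneg_gamma => exact fun t ht => mul_nonneg hc (h.nonneg_gamma t ht)
  case int_alpha => exact h.int_alpha.const_mul c
  case int_beta => exact h.int_beta.const_mul c
  case int_gamma => exact h.int_gamma.const_mul c
  case ineq1 =>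
    intro t₁ t₂ h0 h12 h2
    rw [intervalIntegral.integral_const_mul, hsqrt, hsqrt]
    linarith [mul_le_mul_of_nonneg_left (h.ineq1 t₁ t₂ h0 h12 h2) hc]
  case ineq2 =>
    intro t₁ t₂ h0 h12 h2
    rw [intervalIntegral.integral_const_mul]
    linarith [mul_le_mul_of_nonneg_left (h.ineq2 t₁ t₂ h0 h12 h2) hc]
  case ineq3 =>
    intro t₁ t₂ h0 h12 h2
    rw [intervalIntegral.integral_const_mul, hsup]
    linarith [mul_le_mul_of_nonneg_left (h.ineq3 t₁ t₂ h0 h12 h2) hc]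
  case ineq4 =>
    intro t ht
    linarith [mul_le_mul_of_nonneg_left (h.ineq4 t ht) hc]

/-- Self-improvement of interior bounds for the class `𝓔(·, λ, C₀)`. -/
theorem interior_bound_self_improvement (lam C₀ : ℝ) (hlam : 0 < lam) (hC₀ : 0 < C₀)
    (τ : ℝ) (hτ : 1 ≤ τ) (M : ℝ) (hM : 0 < M)
    (hyp : ∀ T' : ℝ, 2 * τ ≤ T' → ∀ α β γ : ℝ → ℝ, MemE T' lam C₀ α β γ →
      α 0 + γ 0 + α T' + γ T' ≤ 1 →
        ∀ t ∈ Set.Icc τ (T' - τ), α t + γ t ≤ M) :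
    ∀ T : ℝ, 4 * τ ≤ T → ∀ α β γ : ℝ → ℝ, MemE T lam C₀ α β γ →
      α 0 + γ 0 + α T + γ T ≤ 1 →
        ∀ t ∈ Set.Icc (2 * τ) (T - 2 * τ), α t + γ t ≤ 2 * M ^ 2 := by
  intro T hT α β γ h hbd t ht
  have hleft := hyp T (by linarith) α β γ h hbd τ ⟨le_rfl, by linarith⟩
  have hright := hyp T (by linarith) α β γ h hbd (T - τ) ⟨by linarith, le_rfl⟩
  have hmem := (h.restrict_shift (a := τ) (b := T - τ) (by linarith) (by linarith)
    (by linarith)).const_mul (c := (2 * M)⁻¹) (by positivity)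
  have hM2 : (2 * M)⁻¹ * (2 * M) = 1 := inv_mul_cancel₀ (by positivity)
  have hscaled := hyp (T - τ - τ) (by linarith) _ _ _ hmem (by
    simp only [zero_add, sub_add_cancel]
    calc _ = (2 * M)⁻¹ * (α τ + γ τ + (α (T - τ) + γ (T - τ))) := by ring
      _ ≤ (2 * M)⁻¹ * (2 * M) := by gcongr; linarith
      _ = 1 := hM2) (t - τ) ⟨by linarith [ht.1], by linarith [ht.2]⟩
  simp only [sub_add_cancel] at hscaled
  calc α t + γ t = 2 * M * ((2 * M)⁻¹ * α t + (2 * M)⁻¹ * γ t) := by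
        rw [← mul_add, mul_inv_cancel_left₀ (by positivity)]
    _ ≤ 2 * M * M := by gcongr
    _ = 2 * M ^ 2 := by ring
end

section
/- There exist constants C > 0, λ' > 0 and δ₀ > 0, depending only on C₀ and λ, such that for every discount rate δ ∈ (0, δ₀), every triple (α, β, γ) ∈ 𝓔(δ, λ, C₀), and every t ≥ 0, one has α(t) + γ(t) ≤ C e^{−λ' t} γ(0). -/
open MeasureTheory

/-- `f` is càdlàg on `[0, ∞)`: right-continuous at every `t ≥ 0` and
with a (finite) left limit at every `t > 0`. -/
def CadlagOnIci (f : ℝ → ℝ) : Prop :=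
  (∀ t : ℝ, 0 ≤ t → Filter.Tendsto f (nhdsWithin t (Set.Ioi t)) (nhds (f t))) ∧
  (∀ t : ℝ, 0 < t → ∃ L : ℝ, Filter.Tendsto f (nhdsWithin t (Set.Iio t)) (nhds L))

/-- The discounted class `𝓔(δ, λ, C₀)` of triples of nonnegative bounded càdlàg
functions on `[0, ∞)` satisfying the four structural inequalities. -/
structure MemED (δ lam C₀ : ℝ) (α β γ : ℝ → ℝ) : Prop where
  cadlag_alpha : CadlagOnIci α
  cadlag_beta : CadlagOnIci β
  cadlag_gamma : CadlagOnIci γ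
  nonneg_alpha : ∀ t : ℝ, 0 ≤ t → 0 ≤ α t
  nonneg_beta : ∀ t : ℝ, 0 ≤ t → 0 ≤ β t
  nonneg_gamma : ∀ t : ℝ, 0 ≤ t → 0 ≤ γ t
  bdd_alpha : ∃ M : ℝ, ∀ t : ℝ, 0 ≤ t → α t ≤ M
  bdd_beta : ∃ M : ℝ, ∀ t : ℝ, 0 ≤ t → β t ≤ M
  bdd_gamma : ∃ M : ℝ, ∀ t : ℝ, 0 ≤ t → γ t ≤ M
  ineq1 : ∀ t₁ : ℝ, 0 ≤ t₁ →
    (∫ t in Set.Ioi t₁, Real.exp (-δ * t) * β t) ≤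
      C₀ * Real.exp (-δ * t₁) * Real.sqrt (α t₁ * γ t₁)
  ineq2 : ∀ t₁ t₂ : ℝ, 0 ≤ t₁ → t₁ ≤ t₂ →
    γ t₂ ≤ C₀ * Real.exp (-lam * (t₂ - t₁)) * γ t₁ + C₀ * ∫ t in t₁..t₂, β t
  ineq3 : ∀ t₁ : ℝ, 0 ≤ t₁ →
    α t₁ ≤ C₀ * (∫ t in Set.Ioi t₁, Real.exp (-lam * (t - t₁)) * β t)
      + C₀ * sSup ((fun t => Real.exp (-lam * (t - t₁)) * γ t) '' Set.Ici t₁)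
  ineq4 : ∀ t : ℝ, 0 ≤ t → α t ≤ C₀ * β t

open Set Filter Topology

/-- A function that is right-continuous on `[0, ∞)` is a.e. strongly measurable there: it is the
pointwise limit of its samples on the grids `(k + 1) / (n + 1)`. -/
lemma aestronglyMeasurable_Ici_of_right_continuous {f : ℝ → ℝ}
    (hf : ∀ t : ℝ, 0 ≤ t → Tendsto f (𝓝[>] t) (𝓝 (f t))) :
    AEStronglyMeasurable f (volume.restrict (Ici 0)) := by
  let u : ℕ → ℝ → ℝ := fun n t => ((⌊t * ((n : ℝ) + 1)⌋₊ : ℝ) + 1) / ((n : ℝ) + 1)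
  refine aestronglyMeasurable_of_tendsto_ae (f := fun n t => f (u n t)) atTop (fun n => ?_) ?_
  · have hfloor : Measurable fun t : ℝ => ⌊t * ((n : ℝ) + 1)⌋₊ :=
      Nat.measurable_floor.comp (measurable_id.mul_const _)
    exact ((measurable_of_countable
      fun k : ℕ => f (((k : ℝ) + 1) / ((n : ℝ) + 1))).comp hfloor).aestronglyMeasurable
  · filter_upwards [ae_restrict_mem measurableSet_Ici] with t ht
    have ht : 0 ≤ t := ht
    have hlt : ∀ n, t < u n t := fun n => by
      have hn : (0 : ℝ) < n + 1 := by positivity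
      rw [lt_div_iff₀ hn]
      exact Nat.lt_floor_add_one _
    have hle : ∀ n, u n t ≤ t + 1 / ((n : ℝ) + 1) := fun n => by
      have hn : (0 : ℝ) < n + 1 := by positivity
      rw [div_le_iff₀ hn, add_mul, one_div_mul_cancel hn.ne']
      gcongr
      exact Nat.floor_le (by positivity)
    refine (hf t ht).comp (tendsto_nhdsWithin_iff.2 ⟨?_, Eventually.of_forall hlt⟩)
    refine tendsto_of_tendsto_of_tendsto_of_le_of_le tendsto_const_nhds ?_
      (fun n => (hlt n).le) hle
    simpa using tendsto_const_nhds.add (tendsto_one_div_add_atTop_nhds_zero_nat (𝕜 := ℝ))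

/-- Halving over every window of length `P`, together with boundedness on each window, gives
exponential decay. -/
lemma exp_decay_of_halving {g : ℝ → ℝ} {P M : ℝ} (hP : 0 < P) (hM : 0 ≤ M) (hg0 : 0 ≤ g 0)
    (hbound : ∀ s t, 0 ≤ s → s ≤ t → t ≤ s + P → g t ≤ M * g s)
    (hhalf : ∀ s, 0 ≤ s → g (s + P) ≤ g s / 2) {t : ℝ} (ht : 0 ≤ t) :
    g t ≤ 2 * M * Real.exp (-(Real.log 2 / P) * t) * g 0 := by
  have hiter : ∀ n : ℕ, g (n * P) ≤ (1 / 2) ^ n * g 0 := by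
    intro n
    induction n with
    | zero => simp
    | succ n ih =>
      have h := hhalf (n * P) (by positivity)
      rw [pow_succ]
      push_cast
      rw [add_mul, one_mul]
      linarith
  set n := ⌊t / P⌋₊
  have h1 : n * P ≤ t := (le_div_iff₀ hP).1 (Nat.floor_le (by positivity))
  have h2 : t < (n + 1) * P := (div_lt_iff₀ hP).1 (Nat.lt_floor_add_one _)
  have h3 := hbound (n * P) t (by positivity) h1 (by linarith)
  have hexp : (1 / 2 : ℝ) ^ n ≤ 2 * Real.exp (-(Real.log 2 / P) * t) := by
    have hpow : (1 / 2 : ℝ) ^ n = Real.exp (-(Real.log 2 * n)) := by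
      rw [Real.exp_neg, mul_comm, Real.exp_nat_mul, Real.exp_log two_pos, one_div, inv_pow]
    have htwo : 2 * Real.exp (-(Real.log 2 / P) * t)
        = Real.exp (Real.log 2 + -(Real.log 2 / P) * t) := by
      rw [Real.exp_add, Real.exp_log two_pos]
    rw [hpow, htwo, Real.exp_le_exp]
    have hlog : 0 < Real.log 2 := Real.log_pos one_lt_two
    have h4 : t / P < n + 1 := (div_lt_iff₀ hP).2 h2
    have h5 : Real.log 2 / P * t = Real.log 2 * (t / P) := by ring
    nlinarith
  calc g t ≤ M * g (n * P) := h3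
    _ ≤ M * ((1 / 2) ^ n * g 0) := by gcongr; exact hiter n
    _ ≤ M * (2 * Real.exp (-(Real.log 2 / P) * t) * g 0) := by gcongr
    _ = _ := by ring

namespace MemED

variable {δ lam C₀ : ℝ} {α β γ : ℝ → ℝ}

lemma integrableOn_exp_mul (h : MemED δ lam C₀ α β γ) (hδ : 0 < δ) {s : ℝ} (hs : 0 ≤ s) :
    IntegrableOn (fun t => Real.exp (-δ * t) * β t) (Ioi s) := by
  obtain ⟨M, hM⟩ := h.bdd_beta
  have hmeas : AEStronglyMeasurable β (volume.restrict (Ioi s)) :=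
    (aestronglyMeasurable_Ici_of_right_continuous h.cadlag_beta.1).mono_measure
      (Measure.restrict_mono (fun t ht => hs.trans (le_of_lt ht)) le_rfl)
  refine (exp_neg_integrableOn_Ioi s hδ).mul_bdd (c := M) hmeas ?_
  filter_upwards [ae_restrict_mem measurableSet_Ioi] with t ht
  have ht0 : 0 ≤ t := hs.trans (le_of_lt ht)
  rw [Real.norm_of_nonneg (h.nonneg_beta t ht0)]
  exact hM t ht0

lemma intervalIntegrable_beta (h : MemED δ lam C₀ α β γ) (hδ : 0 < δ) {s t : ℝ} (hs : 0 ≤ s)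
    (hst : s ≤ t) : IntervalIntegrable β volume s t := by
  rw [intervalIntegrable_iff_integrableOn_Ioc_of_le hst]
  have hβint := (h.integrableOn_exp_mul hδ hs).mono_set (Ioc_subset_Ioi_self : Ioc s t ⊆ Ioi s)
  refine ((intervalIntegrable_iff_integrableOn_Ioc_of_le hst).1
    (((intervalIntegrable_iff_integrableOn_Ioc_of_le hst).2 hβint).continuousOn_mul
      (g := fun r => Real.exp (δ * r)) (by fun_prop))).congr_fun (fun r _ => ?_) measurableSet_Ioc
  simp only [← mul_assoc, ← Real.exp_add]
  simp

lemma integral_beta_le (h : MemED δ lam C₀ α β γ) (hδ : 0 < δ) {s t : ℝ} (hs : 0 ≤ s)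
    (hst : s ≤ t) :
    ∫ r in s..t, β r ≤ Real.exp (δ * (t - s)) * (C₀ * √(α s * γ s)) := by
  have hβint := h.integrableOn_exp_mul hδ hs
  have hIoc : IntervalIntegrable (fun r => Real.exp (-δ * r) * β r) volume s t :=
    (intervalIntegrable_iff_integrableOn_Ioc_of_le hst).2 (hβint.mono_set Ioc_subset_Ioi_self)
  calc ∫ r in s..t, β r
      ≤ ∫ r in s..t, Real.exp (δ * t) * (Real.exp (-δ * r) * β r) := by
        refine intervalIntegral.integral_mono_on hst (h.intervalIntegrable_beta hδ hs hst)
          (hIoc.const_mul _) fun r hr => ?_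
        rw [← mul_assoc, ← Real.exp_add]
        refine le_mul_of_one_le_left (h.nonneg_beta r (hs.trans hr.1)) (Real.one_le_exp ?_)
        nlinarith [hr.2]
    _ = Real.exp (δ * t) * ∫ r in Ioc s t, Real.exp (-δ * r) * β r := by
        rw [intervalIntegral.integral_const_mul, intervalIntegral.integral_of_le hst]
    _ ≤ Real.exp (δ * t) * ∫ r in Ioi s, Real.exp (-δ * r) * β r := by
        refine mul_le_mul_of_nonneg_left
          (setIntegral_mono_set hβint ?_ Ioc_subset_Ioi_self.eventuallyLE) (Real.exp_pos _).le
        filter_upwards [ae_restrict_mem measurableSet_Ioi] with r hr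
        exact mul_nonneg (Real.exp_pos _).le (h.nonneg_beta r (hs.trans (le_of_lt hr)))
    _ ≤ Real.exp (δ * t) * (C₀ * Real.exp (-δ * s) * √(α s * γ s)) := by
        gcongr
        exact h.ineq1 s hs
    _ = _ := by
        rw [mul_sub, sub_eq_add_neg, Real.exp_add, neg_mul]
        ring

lemma integral_exp_mul_beta_le (h : MemED δ lam C₀ α β γ) (hδ : 0 < δ) (hδlam : δ ≤ lam)
    {s : ℝ} (hs : 0 ≤ s) :
    ∫ r in Ioi s, Real.exp (-lam * (r - s)) * β r ≤ C₀ * √(α s * γ s) := by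
  calc ∫ r in Ioi s, Real.exp (-lam * (r - s)) * β r
      ≤ ∫ r in Ioi s, Real.exp (δ * s) * (Real.exp (-δ * r) * β r) := by
        refine integral_mono_of_nonneg ?_ ((h.integrableOn_exp_mul hδ hs).const_mul _) ?_
        all_goals
          filter_upwards [ae_restrict_mem measurableSet_Ioi] with r hr
          have hsr : s < r := hr
          have hβ := h.nonneg_beta r (hs.trans hsr.le)
        · exact mul_nonneg (Real.exp_pos _).le hβ
        · rw [← mul_assoc, ← Real.exp_add]
          refine mul_le_mul_of_nonneg_right (Real.exp_le_exp.2 ?_) hβ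
          nlinarith
    _ ≤ Real.exp (δ * s) * (C₀ * Real.exp (-δ * s) * √(α s * γ s)) := by
        rw [integral_const_mul]
        gcongr
        exact h.ineq1 s hs
    _ = C₀ * √(α s * γ s) * (Real.exp (δ * s) * Real.exp (-δ * s)) := by ring
    _ = C₀ * √(α s * γ s) := by
        rw [← Real.exp_add]
        simp

lemma alpha_le_gamma (h : MemED δ lam C₀ α β γ) (hC₀ : 0 < C₀) (hδ : 0 < δ) (hδlam : δ ≤ lam)
    {s : ℝ} (hs : 0 ≤ s) :
    α s ≤ ((C₀ ^ 2 + C₀ ^ 3) ^ 2 + 2 * C₀ ^ 2) * γ s := by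
  have hα := h.nonneg_alpha s hs
  have hγ := h.nonneg_gamma s hs
  set R := √(α s * γ s)
  have hR : 0 ≤ R := Real.sqrt_nonneg _
  have hsup : sSup ((fun t => Real.exp (-lam * (t - s)) * γ t) '' Ici s)
      ≤ C₀ * γ s + C₀ ^ 2 * R := by
    refine csSup_le (nonempty_Ici.image _) ?_
    rintro _ ⟨t, ht, rfl⟩
    have hst : s ≤ t := ht
    have hI := h.integral_beta_le hδ hs hst
    have h2 := h.ineq2 s t hs hst
    have he : Real.exp (-lam * (t - s)) ≤ 1 := Real.exp_le_one_iff.2 (by nlinarith)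
    have hee : Real.exp (-lam * (t - s)) * Real.exp (δ * (t - s)) ≤ 1 := by
      rw [← Real.exp_add]
      exact Real.exp_le_one_iff.2 (by nlinarith)
    set E := Real.exp (-lam * (t - s))
    have hE : 0 < E := Real.exp_pos _
    calc E * γ t ≤ E * (C₀ * E * γ s + C₀ * (Real.exp (δ * (t - s)) * (C₀ * R))) := by
          gcongr
          exact h2.trans (by gcongr)
      _ = (E * E) * (C₀ * γ s) + (E * Real.exp (δ * (t - s))) * (C₀ ^ 2 * R) := by ring
      _ ≤ 1 * (C₀ * γ s) + 1 * (C₀ ^ 2 * R) := by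
          gcongr
          exact mul_le_one₀ he hE.le he
      _ = _ := by ring
  have h3 : α s ≤ C₀ * (C₀ * R) + C₀ * (C₀ * γ s + C₀ ^ 2 * R) :=
    (h.ineq3 s hs).trans (by gcongr; exact h.integral_exp_mul_beta_le hδ hδlam hs)
  set p := C₀ ^ 2 + C₀ ^ 3
  have hp : 0 ≤ p := by positivity
  have hamgm : p * R ≤ (α s + p ^ 2 * γ s) / 2 := by
    refine abs_le_of_sq_le_sq' ?_ (by positivity) |>.2
    rw [mul_pow, Real.sq_sqrt (by positivity)]
    nlinarith [sq_nonneg (α s - p ^ 2 * γ s)]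
  have : C₀ * (C₀ * R) + C₀ * (C₀ * γ s + C₀ ^ 2 * R) = p * R + C₀ ^ 2 * γ s := by ring
  linarith

lemma integral_beta_window_le (h : MemED δ lam C₀ α β γ) (hC₀ : 0 < C₀) (hδ : 0 < δ) {s t : ℝ}
    (hs : 0 ≤ s) (hst : s ≤ t) (hwin : δ * (t - s) ≤ 1) {a b : ℝ} (ha : 0 ≤ a)
    (hα : α s ≤ a) (hγ : γ s ≤ b) :
    ∫ r in s..t, β r ≤ Real.exp 1 * (C₀ * √(a * b)) := by
  have := h.nonneg_alpha s hs
  have := h.nonneg_gamma s hs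
  exact (h.integral_beta_le hδ hs hst).trans (by gcongr)

/-- If `β` has small integral over a window of length `T`, then `α` is small somewhere in it. -/
lemma exists_alpha_le (h : MemED δ lam C₀ α β γ) (hC₀ : 0 < C₀) (hδ : 0 < δ) {s T B : ℝ}
    (hs : 0 ≤ s) (hT : 0 < T) (hB : ∫ r in s..s + T, β r ≤ B) :
    ∃ r, s ≤ r ∧ r ≤ s + T ∧ α r ≤ C₀ * B / T := by
  by_contra! hcon
  have hβint := h.intervalIntegrable_beta hδ hs (by linarith : s ≤ s + T)
  obtain ⟨r, hr, hle⟩ : ∃ r ∈ Icc s (s + T), β r ≤ B / T := by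
    by_contra! hβ
    have hlt : ∫ _ in s..s + T, B / T < ∫ r in s..s + T, β r := by
      refine intervalIntegral.integral_lt_integral_of_ae_le_of_measure_setOfPred_lt_ne_zero
        (by linarith) intervalIntegrable_const hβint ?_ ?_
      · filter_upwards [ae_restrict_mem measurableSet_Ioc] with r hr
        exact (hβ r ⟨hr.1.le, hr.2⟩).le
      · refine ne_of_gt (lt_of_lt_of_le ?_ (measure_mono (s := Ioc s (s + T)) ?_))
        · rw [Measure.restrict_apply_self, Real.volume_Ioc]
          simpa using hT
        · exact fun r hr => hβ r ⟨hr.1.le, hr.2⟩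
    rw [intervalIntegral.integral_const, smul_eq_mul, add_sub_cancel_left,
      mul_div_cancel₀ _ hT.ne'] at hlt
    linarith
  have h4 := h.ineq4 r (hs.trans hr.1)
  have h5 := hcon r hr.1 hr.2
  have h6 : C₀ * β r ≤ C₀ * (B / T) := by gcongr
  rw [mul_div_assoc] at h5
  linarith

end MemED

/-- Lemma B.2 (exponential decay, discounted case): there exist `C, λ', δ₀ > 0`
depending only on `C₀` and `λ` such that for every `δ ∈ (0, δ₀)`, every
`(α, β, γ) ∈ 𝓔(δ, λ, C₀)` and every `t ≥ 0`,
`α(t) + γ(t) ≤ C e^{-λ' t} γ(0)`. -/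
theorem expo_decay_discounted (lam C₀ : ℝ) (hlam : 0 < lam) (hC₀ : 0 < C₀) :
    ∃ C : ℝ, 0 < C ∧ ∃ lam' : ℝ, 0 < lam' ∧ ∃ δ₀ : ℝ, 0 < δ₀ ∧
      ∀ δ : ℝ, 0 < δ → δ < δ₀ → ∀ α β γ : ℝ → ℝ, MemED δ lam C₀ α β γ →
        ∀ t : ℝ, 0 ≤ t → α t + γ t ≤ C * Real.exp (-lam' * t) * γ 0 := by
  set K := (C₀ ^ 2 + C₀ ^ 3) ^ 2 + 2 * C₀ ^ 2
  have hK : 0 < K := by positivity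
  set e := Real.exp 1
  have he : 0 < e := Real.exp_pos 1
  set M := C₀ + C₀ * (e * (C₀ * √K)) with hMdef
  have hM : 0 < M := by positivity
  set N := C₀ * (e * (C₀ * √K)) with hNdef
  have hN : 0 < N := by positivity
  set Q := C₀ * (e * C₀) with hQdef
  have hQ : 0 < Q := by positivity
  set T := 16 * Q ^ 2 * (N * M) with hTdef
  have hT : 0 < T := by positivity
  obtain ⟨L, hL0, hL⟩ : ∃ L : ℝ, 0 < L ∧ C₀ * Real.exp (-lam * L) * M ≤ 1 / 4 := by
    have hlim : Tendsto (fun L : ℝ => C₀ * Real.exp (-lam * L) * M) atTop (𝓝 0) := by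
      have := (Real.tendsto_exp_atBot.comp
        (tendsto_id.const_mul_atTop_of_neg (neg_lt_zero.2 hlam))).const_mul C₀ |>.mul_const M
      simpa using this
    obtain ⟨L, h1, h2⟩ := ((eventually_gt_atTop 0).and
      (hlim.eventually_le_const (by norm_num : (0 : ℝ) < 1 / 4))).exists
    exact ⟨L, h1, h2⟩
  have hP : 0 < T + L := by positivity
  refine ⟨(K + 1) * (2 * M), by positivity, Real.log 2 / (T + L),
    div_pos (Real.log_pos one_lt_two) hP, min lam (1 / (T + L)), by positivity, ?_⟩
  intro δ hδ hδlt α β γ h t ht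
  have hδlam : δ ≤ lam := (hδlt.trans_le (min_le_left _ _)).le
  have hδP : δ * (T + L) ≤ 1 := ((lt_div_iff₀ hP).1 (hδlt.trans_le (min_le_right _ _))).le
  have hαγ : ∀ s, 0 ≤ s → α s ≤ K * γ s := fun s hs => h.alpha_le_gamma hC₀ hδ hδlam hs
  have hβint : ∀ s t, 0 ≤ s → s ≤ t → t ≤ s + (T + L) →
      ∫ r in s..t, β r ≤ e * (C₀ * √K) * γ s := by
    intro s t hs hst hts
    have hγs := h.nonneg_gamma s hs
    have := h.integral_beta_window_le hC₀ hδ hs hst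
      (le_trans (by gcongr; linarith) hδP) (by positivity) (hαγ s hs) le_rfl
    rw [mul_assoc, Real.sqrt_mul hK.le, Real.sqrt_mul_self hγs] at this
    exact this.trans_eq (by ring)
  have hbound : ∀ s t, 0 ≤ s → s ≤ t → t ≤ s + (T + L) → γ t ≤ M * γ s := by
    intro s t hs hst hts
    have hγs := h.nonneg_gamma s hs
    have hE : Real.exp (-lam * (t - s)) ≤ 1 := Real.exp_le_one_iff.2 (by nlinarith)
    calc γ t ≤ C₀ * Real.exp (-lam * (t - s)) * γ s + C₀ * ∫ r in s..t, β r :=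
          h.ineq2 s t hs hst
      _ ≤ C₀ * 1 * γ s + C₀ * (e * (C₀ * √K) * γ s) := by
          gcongr
          exact hβint s t hs hst hts
      _ = M * γ s := by rw [hMdef]; ring
  have hhalf : ∀ s, 0 ≤ s → γ (s + (T + L)) ≤ γ s / 2 := by
    intro s hs
    have hγs := h.nonneg_gamma s hs
    obtain ⟨r, hsr, hrs, hαr⟩ := h.exists_alpha_le hC₀ hδ hs hT
      (hβint s (s + T) hs (by linarith) (by linarith))
    have hr : 0 ≤ r := hs.trans hsr
    have hγr := hbound s r hs hsr (by linarith)
    have hI := h.integral_beta_window_le hC₀ hδ hr (by linarith : r ≤ s + (T + L))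
      (le_trans (by gcongr; linarith) hδP) (by positivity) hαr hγr
    have hsqrt : √(C₀ * (e * (C₀ * √K) * γ s) / T * (M * γ s)) = γ s / (4 * Q) := by
      rw [Real.sqrt_eq_iff_mul_self_eq (by positivity) (by positivity)]
      have : C₀ * (e * (C₀ * √K) * γ s) = N * γ s := by rw [hNdef]; ring
      rw [this, hTdef]
      field_simp
      ring
    rw [hsqrt] at hI
    have hE : Real.exp (-lam * (s + (T + L) - r)) ≤ Real.exp (-lam * L) :=
      Real.exp_le_exp.2 (by nlinarith)
    calc γ (s + (T + L))
        ≤ C₀ * Real.exp (-lam * (s + (T + L) - r)) * γ r + C₀ * ∫ u in r..s + (T + L), β u :=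
          h.ineq2 r _ hr (by linarith)
      _ ≤ C₀ * Real.exp (-lam * L) * (M * γ s) + C₀ * (e * (C₀ * (γ s / (4 * Q)))) := by
          have := h.nonneg_gamma r hr
          gcongr
      _ = C₀ * Real.exp (-lam * L) * M * γ s + Q * (γ s / (4 * Q)) := by rw [hQdef]; ring
      _ = C₀ * Real.exp (-lam * L) * M * γ s + γ s / 4 := by
          congr 1
          field_simp
      _ ≤ 1 / 4 * γ s + γ s / 4 := by gcongr
      _ = γ s / 2 := by ring
  have hdecay := exp_decay_of_halving hP hM.le (h.nonneg_gamma 0 le_rfl) hbound hhalf ht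
  calc α t + γ t ≤ (K + 1) * γ t := by linarith [hαγ t ht]
    _ ≤ (K + 1) * (2 * M * Real.exp (-(Real.log 2 / (T + L)) * t) * γ 0) := by gcongr
    _ = _ := by ring
end

section
/- There exists a constant C > 0, depending only on C₀ and λ, such that for every discount rate δ ∈ (0, λ], every triple (α, β, γ) ∈ 𝓔(δ, λ, C₀) with α(0) + γ(0) ≤ 1, and every t ≥ 0, one has e^{−δt}(α(t) + γ(t)) ≤ C, and moreover ∫_{0}^{∞} e^{−δt} β(t) dt ≤ C₀. -/
open MeasureTheory

/-- The grid points `(⌊(n + 1) t⌋ + 1) / (n + 1)` tend to `t` from the right. -/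
theorem tendsto_floor_succ_div_nhdsGT (t : ℝ) :
    Filter.Tendsto (fun n : ℕ => ((⌊((n : ℝ) + 1) * t⌋ : ℝ) + 1) / ((n : ℝ) + 1)) Filter.atTop
      (nhdsWithin t (Set.Ioi t)) := by
  have hpos : ∀ n : ℕ, (0 : ℝ) < (n : ℝ) + 1 := fun n => by positivity
  have hlt : ∀ n : ℕ, t < ((⌊((n : ℝ) + 1) * t⌋ : ℝ) + 1) / ((n : ℝ) + 1) := fun n => by
    rw [lt_div_iff₀ (hpos n), mul_comm]
    exact Int.lt_floor_add_one _
  refine tendsto_nhdsWithin_iff.2 ⟨?_, Filter.Eventually.of_forall hlt⟩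
  refine tendsto_of_tendsto_of_tendsto_of_le_of_le (g := fun _ : ℕ => t)
    (h := fun n : ℕ => t + 1 / ((n : ℝ) + 1)) tendsto_const_nhds ?_ (fun n => (hlt n).le) ?_
  · simpa using tendsto_const_nhds.add (tendsto_one_div_add_atTop_nhds_zero_nat (𝕜 := ℝ))
  · intro n
    have h := Int.floor_le (((n : ℝ) + 1) * t)
    have hn := hpos n
    change _ ≤ t + 1 / ((n : ℝ) + 1)
    rw [div_le_iff₀ hn, add_mul t, one_div, inv_mul_cancel₀ hn.ne']
    linarith

theorem CadlagOnIci.aestronglyMeasurable {f : ℝ → ℝ} (hf : CadlagOnIci f) :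
    AEStronglyMeasurable f (volume.restrict (Set.Ioi (0 : ℝ))) := by
  refine aestronglyMeasurable_of_tendsto_ae Filter.atTop
    (f := fun (n : ℕ) t => f (((⌊((n : ℝ) + 1) * t⌋ : ℝ) + 1) / ((n : ℝ) + 1))) (fun n => ?_) ?_
  · have hg : Measurable (fun k : ℤ => f (((k : ℝ) + 1) / ((n : ℝ) + 1))) := measurable_from_top
    exact (hg.comp (Int.measurable_floor.comp (measurable_id.const_mul _))).aestronglyMeasurable
  · refine (ae_restrict_mem measurableSet_Ioi).mono fun t ht => ?_
    exact (hf.1 t (le_of_lt ht)).comp (tendsto_floor_succ_div_nhdsGT t)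

theorem CadlagOnIci.integrableOn_exp_mul {f : ℝ → ℝ} (hf : CadlagOnIci f)
    (h0 : ∀ t, 0 ≤ t → 0 ≤ f t) (hb : ∃ M : ℝ, ∀ t, 0 ≤ t → f t ≤ M) {r : ℝ} (hr : 0 < r) :
    IntegrableOn (fun t => Real.exp (-r * t) * f t) (Set.Ioi 0) := by
  obtain ⟨M, hM⟩ := hb
  have hexp : IntegrableOn (fun t => Real.exp (-r * t) * M) (Set.Ioi 0) :=
    (exp_neg_integrableOn_Ioi 0 hr).mul_const M
  refine Integrable.mono' hexp ?_ ((ae_restrict_mem measurableSet_Ioi).mono fun t ht => ?_)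
  · exact (by fun_prop : Continuous fun t : ℝ => Real.exp (-r * t)).aestronglyMeasurable.mul
      hf.aestronglyMeasurable
  · have ht' : 0 ≤ t := le_of_lt ht
    rw [Real.norm_of_nonneg (mul_nonneg (Real.exp_pos _).le (h0 t ht'))]
    exact mul_le_mul_of_nonneg_left (hM t ht') (Real.exp_pos _).le

namespace MemED

variable {δ lam C₀ : ℝ} {α β γ : ℝ → ℝ}

theorem integrableOn_discounted_beta (h : MemED δ lam C₀ α β γ) (hδ : 0 < δ) :
    IntegrableOn (fun t => Real.exp (-δ * t) * β t) (Set.Ioi 0) :=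
  h.cadlag_beta.integrableOn_exp_mul h.nonneg_beta h.bdd_beta hδ

theorem setIntegral_discounted_beta_le (h : MemED δ lam C₀ α β γ) (hδ : 0 < δ) {s : Set ℝ}
    (hs : s ⊆ Set.Ioi 0) :
    (∫ t in s, Real.exp (-δ * t) * β t) ≤ ∫ t in Set.Ioi (0 : ℝ), Real.exp (-δ * t) * β t :=
  setIntegral_mono_set (h.integrableOn_discounted_beta hδ)
    ((ae_restrict_mem measurableSet_Ioi).mono fun t ht =>
      mul_nonneg (Real.exp_pos _).le (h.nonneg_beta t (le_of_lt ht)))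
    (Filter.Eventually.of_forall hs)

theorem integral_discounted_beta_le (h : MemED δ lam C₀ α β γ) (hC₀ : 0 < C₀)
    (h1 : α 0 + γ 0 ≤ 1) : (∫ t in Set.Ioi (0 : ℝ), Real.exp (-δ * t) * β t) ≤ C₀ := by
  have hα := h.nonneg_alpha 0 le_rfl
  have hγ := h.nonneg_gamma 0 le_rfl
  have hsqrt : Real.sqrt (α 0 * γ 0) ≤ 1 := Real.sqrt_le_one.2 (by nlinarith)
  have h2 := h.ineq1 0 le_rfl
  simp only [mul_zero, Real.exp_zero, mul_one] at h2
  nlinarith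

theorem discounted_gamma_le (h : MemED δ lam C₀ α β γ) (hlam : 0 < lam) (hC₀ : 0 < C₀)
    (hδ : 0 < δ) (h1 : α 0 + γ 0 ≤ 1) {t : ℝ} (ht : 0 ≤ t) :
    γ t ≤ Real.exp (δ * t) * (C₀ + C₀ * C₀) := by
  have hα := h.nonneg_alpha 0 le_rfl
  have hγ := h.nonneg_gamma 0 le_rfl
  have hint : (∫ s in (0 : ℝ)..t, β s) ≤ Real.exp (δ * t) * C₀ := by
    rw [intervalIntegral.integral_of_le ht]
    calc (∫ s in Set.Ioc 0 t, β s)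
        ≤ ∫ s in Set.Ioc 0 t, Real.exp (δ * t) * (Real.exp (-δ * s) * β s) := by
          refine integral_mono_of_nonneg ?_ ?_ ?_
          · exact (ae_restrict_mem measurableSet_Ioc).mono fun s hs =>
              h.nonneg_beta s (le_of_lt hs.1)
          · exact ((h.integrableOn_discounted_beta hδ).mono_set
              Set.Ioc_subset_Ioi_self).const_mul _
          · refine (ae_restrict_mem measurableSet_Ioc).mono fun s hs => ?_
            change β s ≤ Real.exp (δ * t) * (Real.exp (-δ * s) * β s)
            rw [← mul_assoc, ← Real.exp_add]
            exact le_mul_of_one_le_left (h.nonneg_beta s (le_of_lt hs.1))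
              (Real.one_le_exp (by nlinarith [hs.2]))
      _ = Real.exp (δ * t) * ∫ s in Set.Ioc 0 t, Real.exp (-δ * s) * β s :=
          integral_const_mul _ _
      _ ≤ Real.exp (δ * t) * C₀ := by
          gcongr
          exact (h.setIntegral_discounted_beta_le hδ Set.Ioc_subset_Ioi_self).trans
            (h.integral_discounted_beta_le hC₀ h1)
  have hdecay : Real.exp (-lam * (t - 0)) ≤ 1 := Real.exp_le_one_iff.2 (by nlinarith)
  have hgrow : 1 ≤ Real.exp (δ * t) := Real.one_le_exp (by positivity)
  calc γ t ≤ C₀ * Real.exp (-lam * (t - 0)) * γ 0 + C₀ * ∫ s in (0 : ℝ)..t, β s :=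
        h.ineq2 0 t le_rfl ht
    _ ≤ C₀ * 1 * 1 + C₀ * (Real.exp (δ * t) * C₀) := by
        gcongr
        linarith
    _ ≤ Real.exp (δ * t) * (C₀ + C₀ * C₀) := by nlinarith

theorem discounted_alpha_le (h : MemED δ lam C₀ α β γ) (hlam : 0 < lam) (hC₀ : 0 < C₀)
    (hδ : 0 < δ) (hδlam : δ ≤ lam) (h1 : α 0 + γ 0 ≤ 1) {t : ℝ} (ht : 0 ≤ t) :
    α t ≤ Real.exp (δ * t) * (C₀ * C₀ + C₀ * (C₀ + C₀ * C₀)) := by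
  have hexp : ∀ s, t ≤ s →
      Real.exp (-lam * (s - t)) ≤ Real.exp (δ * t) * Real.exp (-δ * s) := fun s hs => by
    rw [← Real.exp_add]
    exact Real.exp_le_exp.2 (by nlinarith)
  have hint : (∫ s in Set.Ioi t, Real.exp (-lam * (s - t)) * β s) ≤ Real.exp (δ * t) * C₀ := by
    calc (∫ s in Set.Ioi t, Real.exp (-lam * (s - t)) * β s)
        ≤ ∫ s in Set.Ioi t, Real.exp (δ * t) * (Real.exp (-δ * s) * β s) := by
          refine integral_mono_of_nonneg ?_ ?_ ?_
          · exact (ae_restrict_mem measurableSet_Ioi).mono fun s hs =>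
              mul_nonneg (Real.exp_pos _).le (h.nonneg_beta s (ht.trans (le_of_lt hs)))
          · exact ((h.integrableOn_discounted_beta hδ).mono_set
              (Set.Ioi_subset_Ioi ht)).const_mul _
          · refine (ae_restrict_mem measurableSet_Ioi).mono fun s hs => ?_
            change Real.exp (-lam * (s - t)) * β s ≤ Real.exp (δ * t) * (Real.exp (-δ * s) * β s)
            rw [← mul_assoc]
            exact mul_le_mul_of_nonneg_right (hexp s (le_of_lt hs))
              (h.nonneg_beta s (ht.trans (le_of_lt hs)))
      _ = Real.exp (δ * t) * ∫ s in Set.Ioi t, Real.exp (-δ * s) * β s :=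
          integral_const_mul _ _
      _ ≤ Real.exp (δ * t) * C₀ := by
          gcongr
          exact (h.setIntegral_discounted_beta_le hδ (Set.Ioi_subset_Ioi ht)).trans
            (h.integral_discounted_beta_le hC₀ h1)
  have hsup : sSup ((fun s => Real.exp (-lam * (s - t)) * γ s) '' Set.Ici t)
      ≤ Real.exp (δ * t) * (C₀ + C₀ * C₀) := by
    refine csSup_le (Set.nonempty_Ici.image _) ?_
    rintro _ ⟨s, hs, rfl⟩
    have hs0 : 0 ≤ s := ht.trans hs
    calc Real.exp (-lam * (s - t)) * γ s
        ≤ (Real.exp (δ * t) * Real.exp (-δ * s)) * (Real.exp (δ * s) * (C₀ + C₀ * C₀)) :=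
          mul_le_mul (hexp s hs) (h.discounted_gamma_le hlam hC₀ hδ h1 hs0)
            (h.nonneg_gamma s hs0) (by positivity)
      _ = Real.exp (δ * t) * (C₀ + C₀ * C₀) := by
          rw [mul_assoc, ← mul_assoc (Real.exp (-δ * s)), ← Real.exp_add]
          simp
  calc α t ≤ _ := h.ineq3 t ht
    _ ≤ C₀ * (Real.exp (δ * t) * C₀) + C₀ * (Real.exp (δ * t) * (C₀ + C₀ * C₀)) := by gcongr
    _ = _ := by ring

end MemED

/-- A priori discounted bounds: there exists `C > 0` depending only on `C₀` and `λ`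
such that for every `δ ∈ (0, λ]` and every `(α, β, γ) ∈ 𝓔(δ, λ, C₀)` with
`α(0) + γ(0) ≤ 1`, one has `e^{-δt}(α(t) + γ(t)) ≤ C` for all `t ≥ 0`, and moreover
`∫₀^∞ e^{-δt} β(t) dt ≤ C₀`. -/
theorem apriori_bounds_discounted (lam C₀ : ℝ) (hlam : 0 < lam) (hC₀ : 0 < C₀) :
    ∃ C : ℝ, 0 < C ∧
      ∀ δ : ℝ, 0 < δ → δ ≤ lam → ∀ α β γ : ℝ → ℝ, MemED δ lam C₀ α β γ →
        α 0 + γ 0 ≤ 1 →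
          (∀ t : ℝ, 0 ≤ t → Real.exp (-δ * t) * (α t + γ t) ≤ C) ∧
          (∫ t in Set.Ioi (0:ℝ), Real.exp (-δ * t) * β t) ≤ C₀ := by
  refine ⟨(C₀ * C₀ + C₀ * (C₀ + C₀ * C₀)) + (C₀ + C₀ * C₀), by positivity, ?_⟩
  intro δ hδ hδlam α β γ h h1
  refine ⟨fun t ht => ?_, h.integral_discounted_beta_le hC₀ h1⟩
  rw [neg_mul, Real.exp_neg, inv_mul_le_iff₀ (Real.exp_pos _), mul_add]
  exact add_le_add (h.discounted_alpha_le hlam hC₀ hδ hδlam h1 ht)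
    (h.discounted_gamma_le hlam hC₀ hδ h1 ht)
end
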